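/- If A = (A_1,…,A_κ) ∈ SL₂(ℝ)^κ is strongly irreducible and the semigroup generated by A_1,…,A_κ is unbounded in SL₂(ℝ) (i.e. the norms of its elements are not bounded above), then L(A) > 0. (Furstenberg's criterion.) -/

import Mathlib

open MeasureTheory

noncomputable section

abbrev Mat2 : Type := Matrix (Fin 2) (Fin 2) ℝ
abbrev SL2 : Type := Matrix.SpecialLinearGroup (Fin 2) ℝ
abbrev E2 : Type := EuclideanSpace ℝ (Fin 2)
abbrev Pone : Type := Projectivization ℝ E2

instance : TopologicalSpace SL2 :=
  inferInstanceAs (TopologicalSpace { A : Mat2 // A.det = 1 })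

/-- The operator norm of a 2×2 real matrix, acting on Euclidean ℝ². -/
def opNorm (M : Mat2) : ℝ := ‖Matrix.toEuclideanCLM (𝕜 := ℝ) M‖

/-- The continuous linear map on Euclidean ℝ² induced by a matrix in SL₂(ℝ). -/
def toEuc (g : SL2) : E2 →L[ℝ] E2 := Matrix.toEuclideanCLM (𝕜 := ℝ) (g : Mat2)

lemma toEuc_injective (g : SL2) : Function.Injective (toEuc g) := by
  intro x y hxy
  have key : ∀ z, toEuc g⁻¹ (toEuc g z) = z := by
    intro z
    have h1 : ((g⁻¹ : SL2) : Mat2) * (g : Mat2) = 1 := by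
      rw [← Matrix.SpecialLinearGroup.coe_mul, inv_mul_cancel,
        Matrix.SpecialLinearGroup.coe_one]
    calc toEuc g⁻¹ (toEuc g z)
        = (Matrix.toEuclideanCLM (𝕜 := ℝ) (((g⁻¹ : SL2) : Mat2) * (g : Mat2))) z := by
          rw [map_mul]; rfl
      _ = z := by rw [h1, map_one]; rfl
  have := congrArg (toEuc g⁻¹) hxy
  rwa [key, key] at this

/-- The projective action of SL₂(ℝ) on the real projective line ℙ¹. -/
def pact (g : SL2) : Pone → Pone :=
  Projectivization.map (toEuc g).toLinearMap (toEuc_injective g)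

instance : MeasurableSpace Pone :=
  inferInstanceAs (MeasurableSpace (Quotient (projectivizationSetoid ℝ E2)))

instance : TopologicalSpace Pone :=
  inferInstanceAs (TopologicalSpace (Quotient (projectivizationSetoid ℝ E2)))

/-- The ordered product `A_{w_{n-1}} ⋯ A_{w_1} A_{w_0}` of the matrices along a word `w`. -/
def wordProd {κ : ℕ} (A : Fin κ → SL2) {n : ℕ} (w : Fin n → Fin κ) : SL2 :=
  (List.ofFn fun i => A (w i)).reverse.prod

/-- The Lyapunov exponent of the random product of the matrices `A_1, …, A_κ` with
probabilities `p_1, …, p_κ`: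
`L(p,A) = inf_{n ≥ 1} (1/n) ∫_Σ log‖A^n(x)‖ dμ_p(x) = inf_{n ≥ 1} (1/n) Σ_w p(w) log‖A_w‖`,
the integral over the Bernoulli measure `μ_p = p^ℤ` being a finite sum over words of
length `n` since the cocycle is locally constant. -/
def lyapLC {κ : ℕ} (p : Fin κ → ℝ) (A : Fin κ → SL2) : ℝ :=
  ⨅ n : {m : ℕ // 0 < m},
    (((n : ℕ) : ℝ))⁻¹ * ∑ w : Fin (n : ℕ) → Fin κ,
      (∏ i, p (w i)) * Real.log (opNorm ((wordProd A w : SL2) : Mat2))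

/-- The distance `‖B₁ − B₂‖` on tuples of matrices (sup of the operator norms of the
differences of the components). -/
def tdist {κ : ℕ} (B₁ B₂ : Fin κ → SL2) : ℝ :=
  ⨆ i, opNorm ((B₁ i : Mat2) - (B₂ i : Mat2))

/-- Strong irreducibility: no nonempty finite set of projective directions is invariant
under (the projective actions of) all of the matrices `A_i`. -/
def StronglyIrreducible {κ : ℕ} (A : Fin κ → SL2) : Prop :=
  ¬ ∃ V : Set Pone, V.Nonempty ∧ V.Finite ∧ ∀ i, pact (A i) '' V = V

/-- Irreducibility: no projective direction is invariant under all of the matrices `A_i`. -/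
def Irreducible' {κ : ℕ} (A : Fin κ → SL2) : Prop :=
  ¬ ∃ v : Pone, ∀ i, pact (A i) v = v


/-! ### Part 1: planar geometry -/

lemma toEuc_apply0 (g : SL2) (v : E2) : (toEuc g v) 0 = g.1 0 0 * v 0 + g.1 0 1 * v 1 := by
  simp [toEuc, Matrix.ofLp_toEuclideanCLM, Matrix.mulVec, dotProduct, Fin.sum_univ_two]

lemma toEuc_apply1 (g : SL2) (v : E2) : (toEuc g v) 1 = g.1 1 0 * v 0 + g.1 1 1 * v 1 := by
  simp [toEuc, Matrix.ofLp_toEuclideanCLM, Matrix.mulVec, dotProduct, Fin.sum_univ_two]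

lemma toEuc_mul (g h : SL2) : toEuc (g * h) = toEuc g * toEuc h := by
  simp [toEuc]

lemma toEuc_mul_apply (g h : SL2) (v : E2) : toEuc (g * h) v = toEuc g (toEuc h v) := by
  rw [toEuc_mul]; rfl

lemma toEuc_one : toEuc 1 = 1 := by simp [toEuc]

lemma toEuc_inv_apply (g : SL2) (v : E2) : toEuc g⁻¹ (toEuc g v) = v := by
  rw [← toEuc_mul_apply, inv_mul_cancel, toEuc_one]; rfl

lemma toEuc_apply_inv (g : SL2) (v : E2) : toEuc g (toEuc g⁻¹ v) = v := by
  rw [← toEuc_mul_apply, mul_inv_cancel, toEuc_one]; rfl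

/-- The area form on the plane. -/
def dt (v w : E2) : ℝ := v 0 * w 1 - v 1 * w 0

lemma dt_toEuc (g : SL2) (v w : E2) : dt (toEuc g v) (toEuc g w) = dt v w := by
  have h : g.1.det = 1 := g.2
  rw [Matrix.det_fin_two] at h
  unfold dt
  rw [toEuc_apply0, toEuc_apply0, toEuc_apply1, toEuc_apply1]
  linear_combination (v 0 * w 1 - v 1 * w 0) * h

lemma norm_sq_E2 (v : E2) : ‖v‖ ^ 2 = v 0 ^ 2 + v 1 ^ 2 := by
  rw [EuclideanSpace.norm_sq_eq, Fin.sum_univ_two]; simp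

lemma abs_dt_le (v w : E2) : |dt v w| ≤ ‖v‖ * ‖w‖ := by
  apply abs_le_of_sq_le_sq _ (by positivity)
  rw [mul_pow, norm_sq_E2, norm_sq_E2]
  unfold dt
  nlinarith [sq_nonneg (v 0 * w 0 + v 1 * w 1)]

lemma dt_smul_left (a : ℝ) (v w : E2) : dt (a • v) w = a * dt v w := by
  simp [dt]; ring

lemma dt_sub_left (v v' w : E2) : dt (v - v') w = dt v w - dt v' w := by
  simp [dt]; ring

lemma cramer (v w x : E2) : dt v w • x = dt x w • v + dt v x • w := by
  ext i
  fin_cases i <;> simp [dt] <;> ring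

/-- Open double cone around the direction `v`. -/
def cone (v : E2) (ε : ℝ) : Set E2 := {x | |dt v x| < ε * ‖v‖ * ‖x‖}

lemma measurableSet_cone (v : E2) (ε : ℝ) : MeasurableSet (cone v ε) := by
  apply IsOpen.measurableSet
  apply isOpen_lt
  · unfold dt; fun_prop
  · fun_prop

lemma cone_smul (a : ℝ) (ha : a ≠ 0) (v : E2) (ε : ℝ) : cone (a • v) ε = cone v ε := by
  ext x
  simp only [cone, Set.mem_ofPred_eq, dt_smul_left, abs_mul, norm_smul, Real.norm_eq_abs]
  have : 0 < |a| := abs_pos.mpr ha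
  rw [show ε * (|a| * ‖v‖) * ‖x‖ = |a| * (ε * ‖v‖ * ‖x‖) by ring]
  exact mul_lt_mul_iff_right₀ this

lemma cone_disjoint (v w : E2) (ε : ℝ) (h : 2 * ε * (‖v‖ * ‖w‖) < |dt v w|) :
    Disjoint (cone v ε) (cone w ε) := by
  rw [Set.disjoint_left]
  intro x hv hw
  simp only [cone, Set.mem_ofPred_eq] at hv hw
  have h1 := congrArg norm (cramer v w x)
  have h2 := norm_add_le (dt x w • v) (dt v x • w)
  rw [← h1] at h2
  simp only [norm_smul, Real.norm_eq_abs] at h2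
  have h3 : |dt x w| = |dt w x| := by
    rw [← abs_neg]; congr 1; simp [dt]; ring
  rw [h3] at h2
  have h4 : |dt w x| * ‖v‖ ≤ ε * ‖w‖ * ‖x‖ * ‖v‖ := by gcongr
  have h5 : |dt v x| * ‖w‖ ≤ ε * ‖v‖ * ‖x‖ * ‖w‖ := by gcongr
  have hx : 0 < ‖x‖ := by
    rcases (norm_nonneg x).lt_or_eq with h | h
    · exact h
    · rw [← h] at hv; have := abs_nonneg (dt v x); linarith
  have := mul_lt_mul_of_pos_right h hx
  linarith

lemma cone_subset_preimage (g : SL2) (v : E2) :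
    ∃ K : ℝ, 0 < K ∧ ∀ ε, 0 ≤ ε → cone v ε ⊆ toEuc g ⁻¹' cone (toEuc g v) (K * ε) := by
  refine ⟨(‖toEuc g⁻¹‖ + 1) ^ 2, by positivity, ?_⟩
  intro ε hε x hx
  simp only [cone, Set.mem_ofPred_eq, Set.mem_preimage, dt_toEuc] at hx ⊢
  have key : ∀ y : E2, ‖y‖ ≤ (‖toEuc g⁻¹‖ + 1) * ‖toEuc g y‖ := by
    intro y
    calc ‖y‖ = ‖toEuc g⁻¹ (toEuc g y)‖ := by rw [toEuc_inv_apply]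
      _ ≤ ‖toEuc g⁻¹‖ * ‖toEuc g y‖ := (toEuc g⁻¹).le_opNorm _
      _ ≤ _ := by gcongr; linarith
  calc |dt v x| < ε * ‖v‖ * ‖x‖ := hx
    _ ≤ ε * ((‖toEuc g⁻¹‖ + 1) * ‖toEuc g v‖) * ((‖toEuc g⁻¹‖ + 1) * ‖toEuc g x‖) := by
      gcongr <;> exact key _
    _ = _ := by ring

lemma cone_subset_of_close (v w : E2) (hv : ‖v‖ = 1) (hw : ‖w‖ = 1) (ε : ℝ)
    (h : ‖w - v‖ < ε / 2) : cone w (ε / 2) ⊆ cone v ε := by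
  intro x hx
  simp only [cone, Set.mem_ofPred_eq, hv, hw] at hx ⊢
  have h1 := abs_dt_le (w - v) x
  rw [dt_sub_left] at h1
  have h2 : |dt v x| ≤ |dt w x| + |dt w x - dt v x| := by
    have := abs_sub_abs_le_abs_sub (dt v x) (dt w x)
    rw [abs_sub_comm] at this; linarith
  have h3 : ‖w - v‖ * ‖x‖ ≤ ε / 2 * ‖x‖ := by gcongr
  linarith

/-- The dynamics of a matrix with large norm: everything but a small cone goes to a
small cone. -/
lemma big_matrix (g : SL2) (ε R : ℝ) (hε : 0 < ε) (hR : 0 < R) (hRε : 1 < (ε * R) ^ 2 * ε)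
    (e : E2) (he : R * ‖e‖ < ‖toEuc g e‖) :
    toEuc g e ≠ 0 ∧ ∃ v : E2, v ≠ 0 ∧
      (Set.univ : Set E2) ⊆ {0} ∪ (toEuc g ⁻¹' cone (toEuc g e) ε ∪ cone v ε) := by
  have hge : 0 < ‖toEuc g e‖ := lt_of_le_of_lt (by positivity) he
  have he0 : e ≠ 0 := by
    rintro rfl; simp at hge
  have hen : 0 < ‖e‖ := norm_pos_iff.mpr he0
  refine ⟨norm_pos_iff.mp hge, ?_⟩
  have bad : ∀ x : E2, toEuc g x ∉ cone (toEuc g e) ε → ε * R * ‖toEuc g x‖ ≤ ‖x‖ := by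
    intro x hx
    simp only [cone, Set.mem_ofPred_eq, dt_toEuc, not_lt] at hx
    have h1 := hx.trans (abs_dt_le e x)
    have h2 : ε * (R * ‖e‖) * ‖toEuc g x‖ ≤ ε * ‖toEuc g e‖ * ‖toEuc g x‖ := by gcongr
    have h3 : ‖e‖ * (ε * R * ‖toEuc g x‖) ≤ ‖e‖ * ‖x‖ := by linarith
    exact le_of_mul_le_mul_left h3 hen
  by_cases hb : ∃ v : E2, v ≠ 0 ∧ toEuc g v ∉ cone (toEuc g e) ε
  · obtain ⟨v, hv, hvb⟩ := hb
    refine ⟨v, hv, ?_⟩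
    intro x _
    by_cases hx : x = 0
    · left; exact hx
    right
    by_cases hxb : toEuc g x ∈ cone (toEuc g e) ε
    · left; exact hxb
    right
    have h1 := bad v hvb
    have h2 := bad x hxb
    have h3 := abs_dt_le (toEuc g v) (toEuc g x)
    rw [dt_toEuc] at h3
    have hvn : 0 < ‖v‖ := norm_pos_iff.mpr hv
    have hxn : 0 < ‖x‖ := norm_pos_iff.mpr hx
    show |dt v x| < ε * ‖v‖ * ‖x‖
    have h4 : (ε * R * ‖toEuc g v‖) * (ε * R * ‖toEuc g x‖) ≤ ‖v‖ * ‖x‖ := by gcongr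
    have h5 : (ε * R) ^ 2 * |dt v x| ≤ ‖v‖ * ‖x‖ := by
      calc (ε * R) ^ 2 * |dt v x| ≤ (ε * R) ^ 2 * (‖toEuc g v‖ * ‖toEuc g x‖) := by gcongr
        _ ≤ _ := by linarith
    have h6 : 0 < ‖v‖ * ‖x‖ := by positivity
    have h7 : (ε * R) ^ 2 * |dt v x| < (ε * R) ^ 2 * (ε * ‖v‖ * ‖x‖) := by
      nlinarith
    exact lt_of_mul_lt_mul_left h7 (by positivity)
  · push Not at hb
    refine ⟨e, he0, ?_⟩
    intro x _
    by_cases hx : x = 0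
    · left; exact hx
    · right; left; exact hb x hx

/-! ### Part 2: no invariant finitely additive mean -/

structure IsMean (M : Set E2 → ℝ) : Prop where
  nonneg : ∀ E, 0 ≤ M E
  mono : ∀ E F, E ⊆ F → M E ≤ M F
  univ : M Set.univ = 1
  zero : M {0} = 0
  union_le : ∀ E F, M (E ∪ F) ≤ M E + M F
  union : ∀ E F, MeasurableSet E → MeasurableSet F → Disjoint E F → M (E ∪ F) = M E + M F

def MInv (M : Set E2 → ℝ) (g : SL2) : Prop :=
  ∀ E, MeasurableSet E → M (toEuc g ⁻¹' E) = M E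

lemma MInv.mul {M : Set E2 → ℝ} {g h : SL2} (hg : MInv M g) (hh : MInv M h) :
    MInv M (g * h) := by
  intro E hE
  have : toEuc (g * h) ⁻¹' E = toEuc h ⁻¹' (toEuc g ⁻¹' E) := by
    ext x; simp [toEuc_mul_apply]
  rw [this, hh _ ((toEuc g).continuous.measurable hE), hg _ hE]

lemma MInv.inv {M : Set E2 → ℝ} {g : SL2} (hg : MInv M g) : MInv M g⁻¹ := by
  intro E hE
  rw [← hg _ ((toEuc g⁻¹).continuous.measurable hE)]
  congr 1
  ext x; simp [toEuc_inv_apply]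

/-- `v` carries an (infinitesimal) atom of mass at least `1/2`. -/
def Heavy (M : Set E2 → ℝ) (v : E2) : Prop := ∀ ε : ℝ, 0 < ε → 1 / 2 ≤ M (cone v ε)

lemma Heavy.map {M : Set E2 → ℝ} (hM : IsMean M) {g : SL2} (hg : MInv M g) {v : E2}
    (hv : Heavy M v) : Heavy M (toEuc g v) := by
  intro ε hε
  obtain ⟨K, hK, h⟩ := cone_subset_preimage g v
  have h1 := h (ε / K) (by positivity)
  rw [mul_div_cancel₀ _ hK.ne'] at h1
  calc 1 / 2 ≤ M (cone v (ε / K)) := hv _ (by positivity)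
    _ ≤ _ := hM.mono _ _ h1
    _ = _ := hg _ (measurableSet_cone _ _)

lemma Heavy.smul {M : Set E2 → ℝ} {v : E2} (hv : Heavy M v) {a : ℝ} (ha : a ≠ 0) :
    Heavy M (a • v) := by
  intro ε hε
  rw [cone_smul a ha]; exact hv ε hε

def heavySet (M : Set E2 → ℝ) : Set Pone := {P | Heavy M P.rep}

lemma heavy_mk {M : Set E2 → ℝ} {v : E2} (hv0 : v ≠ 0) (hv : Heavy M v) :
    Projectivization.mk ℝ v hv0 ∈ heavySet M := by
  obtain ⟨a, ha⟩ := Projectivization.exists_smul_eq_mk_rep ℝ v hv0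
  show Heavy M _
  rw [← ha]
  exact hv.smul a.ne_zero

lemma pact_eq (g : SL2) (P : Pone) : pact g P = Projectivization.mk ℝ (toEuc g P.rep)
    (by intro h; exact P.rep_nonzero (toEuc_injective g (by rw [h, map_zero]))) := by
  conv_lhs => rw [← P.mk_rep]
  rfl

lemma heavy_pact {M : Set E2 → ℝ} (hM : IsMean M) {g : SL2} (hg : MInv M g) {P : Pone}
    (hP : P ∈ heavySet M) : pact g P ∈ heavySet M := by
  rw [pact_eq]
  exact heavy_mk _ (Heavy.map hM hg hP)

lemma pact_pact_inv (g : SL2) (P : Pone) : pact g (pact g⁻¹ P) = P := by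
  induction P using Projectivization.ind with
  | h v hv =>
    simp only [pact, Projectivization.map_mk]
    rw [Projectivization.mk_eq_mk_iff']
    refine ⟨1, ?_⟩
    rw [one_smul]
    exact (toEuc_apply_inv g v).symm

lemma dt_rep_ne {P Q : Pone} (h : P ≠ Q) : dt P.rep Q.rep ≠ 0 := by
  intro h0
  apply h
  rw [← P.mk_rep, ← Q.mk_rep, Projectivization.mk_eq_mk_iff']
  have hq : 0 < ‖Q.rep‖ ^ 2 := by have := norm_pos_iff.mpr Q.rep_nonzero; positivity
  have hq' := hq.ne'
  rw [norm_sq_E2] at hq'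
  refine ⟨(P.rep 0 * Q.rep 0 + P.rep 1 * Q.rep 1) / (Q.rep 0 ^ 2 + Q.rep 1 ^ 2), ?_⟩
  unfold dt at h0
  ext i
  fin_cases i
  · simp only [Fin.zero_eta, PiLp.smul_apply, smul_eq_mul]
    field_simp
    linear_combination (- Q.rep 1) * h0
  · simp only [Fin.mk_one, PiLp.smul_apply, smul_eq_mul]
    field_simp
    linear_combination (Q.rep 0) * h0

lemma heavySet_finite {M : Set E2 → ℝ} (hM : IsMean M) : (heavySet M).Finite := by
  classical
  by_contra hinf
  obtain ⟨s, hs, hcard⟩ := Set.Infinite.exists_subset_card_eq hinf 3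
  have hev : ∀ᶠ ε : ℝ in nhdsWithin 0 (Set.Ioi 0), ∀ P ∈ s, ∀ Q ∈ s, P ≠ Q →
      Disjoint (cone P.rep ε) (cone Q.rep ε) := by
    rw [Filter.eventually_all_finset]
    intro P _
    rw [Filter.eventually_all_finset]
    intro Q _
    by_cases hPQ : P = Q
    · simp [hPQ]
    have h1 : Filter.Tendsto (fun ε : ℝ => 2 * ε * (‖P.rep‖ * ‖Q.rep‖))
        (nhdsWithin 0 (Set.Ioi 0)) (nhds 0) := by
      apply Filter.Tendsto.mono_left _ nhdsWithin_le_nhds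
      have : Continuous (fun ε : ℝ => 2 * ε * (‖P.rep‖ * ‖Q.rep‖)) := by fun_prop
      simpa using this.tendsto 0
    have h2 := h1.eventually_lt_const (abs_pos.mpr (dt_rep_ne hPQ))
    filter_upwards [h2] with ε hε _
    exact cone_disjoint _ _ _ hε
  obtain ⟨ε, hε, hε0⟩ := (hev.and self_mem_nhdsWithin).exists
  have hε0 : 0 < ε := hε0
  have key : ∀ t : Finset Pone, t ⊆ s → (t.card : ℝ) / 2 ≤ M (⋃ P ∈ t, cone P.rep ε) := by
    intro t
    induction t using Finset.induction_on with
    | empty => intro _; simpa using hM.nonneg _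
    | insert P t hPt ih =>
      intro hts
      have hts' : t ⊆ s := fun x hx => hts (Finset.mem_insert_of_mem hx)
      have hPs : P ∈ s := hts (Finset.mem_insert_self _ _)
      rw [Finset.set_biUnion_insert, hM.union]
      · rw [Finset.card_insert_of_notMem hPt]
        have h1 : 1 / 2 ≤ M (cone P.rep ε) := hs hPs ε hε0
        have h2 := ih hts'
        push_cast
        linarith
      · exact measurableSet_cone _ _
      · exact Finset.measurableSet_biUnion _ fun Q _ => measurableSet_cone _ _
      · rw [Set.disjoint_iUnion₂_right]
        intro Q hQ
        apply hε P hPs Q (hts' hQ)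
        rintro rfl
        exact hPt hQ
  have h1 := key s (Finset.Subset.refl _)
  have h2 := hM.mono _ _ (Set.subset_univ (⋃ P ∈ s, cone P.rep ε))
  rw [hM.univ] at h2
  rw [hcard] at h1
  norm_num at h1
  linarith

lemma exists_heavy {κ : ℕ} {A : Fin κ → SL2} {M : Set E2 → ℝ} (hM : IsMean M)
    (hinv : ∀ i, MInv M (A i))
    (hUnb : ¬ ∃ C : ℝ, ∀ g : SL2, g ∈ Subsemigroup.closure (Set.range A) →
      opNorm (g : Mat2) ≤ C) : ∃ v : E2, v ≠ 0 ∧ Heavy M v := by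
  by_contra hno
  push Not at hno
  have hsemi : ∀ g ∈ Subsemigroup.closure (Set.range A), MInv M g := by
    intro g hg
    induction hg using Subsemigroup.closure_induction with
    | mem x hx => obtain ⟨i, rfl⟩ := hx; exact hinv i
    | mul x y _ _ hx hy => exact hx.mul hy
  have hunif : ∃ ε : ℝ, 0 < ε ∧ ∀ v ∈ Metric.sphere (0 : E2) 1, M (cone v ε) < 1 / 2 := by
    have hsm : ∀ (v : E2) (a b : ℝ), a ≤ b → cone v a ⊆ cone v b := by
      intro v a b hab x hx
      have hx' : |dt v x| < a * ‖v‖ * ‖x‖ := hx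
      have hle : a * ‖v‖ * ‖x‖ ≤ b * ‖v‖ * ‖x‖ := by gcongr
      exact lt_of_lt_of_le hx' hle
    have hc : IsCompact (Metric.sphere (0 : E2) 1) := isCompact_sphere _ _
    have hloc : ∀ x ∈ Metric.sphere (0 : E2) 1, ∃ t ∈ nhdsWithin x (Metric.sphere (0 : E2) 1),
        ∃ ε : ℝ, 0 < ε ∧ ∀ v ∈ t, v ∈ Metric.sphere (0 : E2) 1 → M (cone v ε) < 1 / 2 := by
      intro x hx
      have hx1 : ‖x‖ = 1 := by simpa using hx
      have hx0 : x ≠ 0 := by rintro rfl; simp at hx1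
      have hh := hno x hx0
      unfold Heavy at hh
      push Not at hh
      obtain ⟨ε, hε, hlt⟩ := hh
      refine ⟨Metric.ball x (ε / 2), mem_nhdsWithin_of_mem_nhds
        (Metric.ball_mem_nhds _ (by positivity)), ε / 2, by positivity, ?_⟩
      intro v hv hvs
      refine lt_of_le_of_lt (hM.mono _ _ (cone_subset_of_close x v hx1 (by simpa using hvs) ε ?_))
        hlt
      simpa [dist_eq_norm] using hv
    obtain ⟨ε, h0, h1⟩ := hc.induction_on
      (p := fun t => ∃ ε : ℝ, 0 < ε ∧ ∀ v ∈ t, v ∈ Metric.sphere (0 : E2) 1 →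
        M (cone v ε) < 1 / 2)
      ⟨1, one_pos, by simp⟩
      (by
        rintro s t hst ⟨ε, h0, h1⟩
        exact ⟨ε, h0, fun v hv => h1 v (hst hv)⟩)
      (by
        rintro s t ⟨ε, h0, h1⟩ ⟨ε', h0', h1'⟩
        refine ⟨min ε ε', lt_min h0 h0', ?_⟩
        rintro v (hv | hv) hvs
        · exact (hM.mono _ _ (hsm v _ _ (min_le_left _ _))).trans_lt (h1 v hv hvs)
        · exact (hM.mono _ _ (hsm v _ _ (min_le_right _ _))).trans_lt (h1' v hv hvs))
      hloc
    exact ⟨ε, h0, fun v hv => h1 v hv hv⟩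
  obtain ⟨ε, hε, hsph⟩ := hunif
  have hall : ∀ v : E2, v ≠ 0 → M (cone v ε) < 1 / 2 := by
    intro v hv
    have hn : ‖v‖ ≠ 0 := norm_ne_zero_iff.mpr hv
    rw [← cone_smul (‖v‖⁻¹) (inv_ne_zero hn)]
    apply hsph
    simp [norm_smul, hn]
  set R : ℝ := (1 / ε) * (1 + 1 / ε) with hRdef
  have hR : 0 < R := by positivity
  have hRε : 1 < (ε * R) ^ 2 * ε := by
    have : ε * R = 1 + 1 / ε := by rw [hRdef]; field_simp
    rw [this]
    have h2 : (1 + 1 / ε) ^ 2 * ε = ε + 2 + 1 / ε := by field_simp; ring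
    rw [h2]
    have : 0 < 1 / ε := by positivity
    linarith
  push Not at hUnb
  obtain ⟨g, hg, hgn⟩ := hUnb R
  have hex : ∃ e : E2, R * ‖e‖ < ‖toEuc g e‖ := by
    by_contra hcon
    push Not at hcon
    have := (toEuc g).opNorm_le_bound hR.le hcon
    exact absurd this (not_le.mpr hgn)
  obtain ⟨e, he⟩ := hex
  obtain ⟨hge, v, hv, hcov⟩ := big_matrix g ε R hε hR hRε e he
  have h1 := hM.mono _ _ hcov
  have h2 := hM.union_le {0} (toEuc g ⁻¹' cone (toEuc g e) ε ∪ cone v ε)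
  have h3 := hM.union_le (toEuc g ⁻¹' cone (toEuc g e) ε) (cone v ε)
  rw [hsemi g hg _ (measurableSet_cone _ _)] at h3
  rw [hM.univ] at h1
  rw [hM.zero] at h2
  have h4 := hall _ hge
  have h5 := hall _ hv
  linarith

lemma no_mean {κ : ℕ} {A : Fin κ → SL2} (hSI : StronglyIrreducible A)
    (hUnb : ¬ ∃ C : ℝ, ∀ g : SL2, g ∈ Subsemigroup.closure (Set.range A) →
      opNorm (g : Mat2) ≤ C) {M : Set E2 → ℝ} (hM : IsMean M)
    (hinv : ∀ i, MInv M (A i)) : False := by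
  obtain ⟨v, hv0, hv⟩ := exists_heavy hM hinv hUnb
  apply hSI
  refine ⟨heavySet M, ⟨_, heavy_mk hv0 hv⟩, heavySet_finite hM, ?_⟩
  intro i
  apply Set.Subset.antisymm
  · rintro _ ⟨P, hP, rfl⟩
    exact heavy_pact hM (hinv i) hP
  · intro P hP
    exact ⟨pact (A i)⁻¹ P, heavy_pact hM (hinv i).inv hP, pact_pact_inv _ _⟩

/-! ### Part 3: the unitary representation on `L²(ℝ²)` -/

abbrev H2 : Type := Lp ℝ 2 (volume : Measure E2)

lemma mp_toEuc (g : SL2) : MeasurePreserving (toEuc g) (volume : Measure E2) volume := by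
  have hdet : LinearMap.det ((toEuc g : E2 →L[ℝ] E2) : E2 →ₗ[ℝ] E2) = 1 := by
    have h : g.1.det = 1 := g.2
    rw [← h]
    unfold toEuc
    rw [Matrix.coe_toEuclideanCLM_eq_toEuclideanLin, Matrix.toEuclideanLin_eq_toLin,
      LinearMap.det_toLin]
  refine ⟨(toEuc g).continuous.measurable, ?_⟩
  have := Measure.map_linearMap_addHaar_eq_smul_addHaar (volume : Measure E2)
    (f := ((toEuc g : E2 →L[ℝ] E2) : E2 →ₗ[ℝ] E2)) (by rw [hdet]; exact one_ne_zero)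
  rw [hdet] at this
  simpa using this

def U (g : SL2) : H2 →L[ℝ] H2 :=
  (Lp.compMeasurePreservingₗᵢ ℝ (toEuc g) (mp_toEuc g)).toContinuousLinearMap

lemma U_apply (g : SL2) (f : H2) :
    U g f = Lp.compMeasurePreserving (toEuc g) (mp_toEuc g) f := rfl

lemma norm_U (g : SL2) (f : H2) : ‖U g f‖ = ‖f‖ := by
  rw [U_apply]; exact Lp.norm_compMeasurePreserving f _

lemma U_coe (g : SL2) (f : H2) : (U g f : E2 → ℝ) =ᵐ[volume] f ∘ toEuc g :=
  Lp.coeFn_compMeasurePreserving f (mp_toEuc g)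

lemma U_mul (g h : SL2) : U (g * h) = U h * U g := by
  ext1 f
  show U (g * h) f = U h (U g f)
  rw [U_apply, U_apply, U_apply, ← Lp.compMeasurePreserving_comp_apply f (mp_toEuc g) (mp_toEuc h)]
  congr! 2
  funext x
  exact toEuc_mul_apply g h x

lemma U_one : U 1 = 1 := by
  ext1 f
  rw [U_apply]
  apply Lp.ext
  refine (Lp.coeFn_compMeasurePreserving f _).trans ?_
  rw [toEuc_one]
  rfl

/-- The integral of `f²` over `E`. -/
def nu (f : H2) (E : Set E2) : ℝ := ((volume : Measure E2).withDensity fun x => ‖f x‖ₑ ^ 2).real E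

lemma nu_univ_ennreal (f : H2) :
    ((volume : Measure E2).withDensity fun x => ‖f x‖ₑ ^ 2) Set.univ = ENNReal.ofReal (‖f‖ ^ 2) := by
  rw [withDensity_apply _ MeasurableSet.univ, Measure.restrict_univ]
  have h1 := eLpNorm_nnreal_pow_eq_lintegral (f := f) (p := 2) (μ := (volume : Measure E2))
    (by norm_num)
  rw [Lp.norm_def, ENNReal.ofReal_pow ENNReal.toReal_nonneg, ENNReal.ofReal_toReal (Lp.eLpNorm_ne_top f)]
  norm_num at h1
  exact h1.symm

instance (f : H2) : IsFiniteMeasure ((volume : Measure E2).withDensity fun x => ‖f x‖ₑ ^ 2) :=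
  ⟨by rw [nu_univ_ennreal]; exact ENNReal.ofReal_lt_top⟩

lemma nu_univ (f : H2) : nu f Set.univ = ‖f‖ ^ 2 := by
  rw [nu, Measure.real, nu_univ_ennreal, ENNReal.toReal_ofReal (by positivity)]

lemma nu_le (f : H2) (E : Set E2) : nu f E ≤ ‖f‖ ^ 2 := by
  rw [← nu_univ]; exact measureReal_mono (Set.subset_univ _)

lemma nu_eq (f : H2) {E : Set E2} (hE : MeasurableSet E) : nu f E = ∫ x in E, f x ^ 2 := by
  rw [nu, Measure.real, withDensity_apply _ hE, integral_eq_lintegral_of_nonneg_ae]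
  · congr 1
    apply lintegral_congr
    intro x
    rw [← sq_abs, ENNReal.ofReal_pow (abs_nonneg _), ← Real.norm_eq_abs, ofReal_norm]
  · exact Filter.Eventually.of_forall fun x => sq_nonneg _
  · exact ((Lp.aestronglyMeasurable f).pow 2).restrict

lemma nu_preimage (g : SL2) (f : H2) {E : Set E2} (hE : MeasurableSet E) :
    nu (U g f) (toEuc g ⁻¹' E) = nu f E := by
  have hpre : MeasurableSet (toEuc g ⁻¹' E) := (toEuc g).continuous.measurable hE
  have hemb : MeasurableEmbedding (toEuc g) :=
    (toEuc g).continuous.measurableEmbedding (toEuc_injective g)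
  rw [nu_eq _ hpre, nu_eq _ hE, ← (mp_toEuc g).setIntegral_preimage_emb hemb (fun x => f x ^ 2) E]
  apply setIntegral_congr_ae hpre
  filter_upwards [U_coe g f] with x hx _
  rw [hx]; rfl

lemma nu_sub_le (f h : H2) {E : Set E2} (hE : MeasurableSet E) :
    |nu f E - nu h E| ≤ ‖f - h‖ * ‖f + h‖ := by
  have hf2 : Integrable (fun x => f x ^ 2) (volume : Measure E2) := (Lp.memLp f).integrable_sq
  have hh2 : Integrable (fun x => h x ^ 2) (volume : Measure E2) := (Lp.memLp h).integrable_sq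
  rw [nu_eq _ hE, nu_eq _ hE, ← integral_sub hf2.integrableOn hh2.integrableOn]
  calc |∫ x in E, (f x ^ 2 - h x ^ 2)| ≤ ∫ x in E, |f x ^ 2 - h x ^ 2| := abs_integral_le_integral_abs
    _ ≤ ∫ x, |f x ^ 2 - h x ^ 2| := setIntegral_le_integral (hf2.sub hh2).abs
        (Filter.Eventually.of_forall fun x => abs_nonneg _)
    _ = inner ℝ |f - h| |f + h| := by
        rw [L2.inner_def]
        apply integral_congr_ae
        filter_upwards [Lp.coeFn_abs (f - h), Lp.coeFn_abs (f + h), Lp.coeFn_sub f h,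
          Lp.coeFn_add f h] with x h1 h2 h3 h4
        rw [h1, h2, h3, h4]
        simp only [Pi.sub_apply, Pi.add_apply]
        rw [real_inner_comm]
        simp only [RCLike.inner_apply, conj_trivial]
        rw [← abs_mul]
        congr 1; ring
    _ ≤ ‖|f - h|‖ * ‖|f + h|‖ := real_inner_le_norm _ _
    _ = _ := by rw [norm_abs_eq_norm, norm_abs_eq_norm]

/-- Almost invariant vectors produce an invariant mean. -/
lemma mean_of_almost_invariant {κ : ℕ} {A : Fin κ → SL2} (f : ℕ → H2) (hf1 : ∀ k, ‖f k‖ ≤ 1)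
    (hf : Filter.Tendsto (fun k => ‖f k‖) Filter.atTop (nhds 1))
    (hA : ∀ i, Filter.Tendsto (fun k => ‖f k - U (A i) (f k)‖) Filter.atTop (nhds 0)) :
    ∃ M : Set E2 → ℝ, IsMean M ∧ ∀ i, MInv M (A i) := by
  set u : Ultrafilter ℕ := Filter.hyperfilter ℕ with hu
  have hule : (u : Filter ℕ) ≤ Filter.atTop := by
    rw [hu, ← Nat.cofinite_eq_atTop]; exact Filter.hyperfilter_le_cofinite
  have hex : ∀ E : Set E2, ∃ m : ℝ, Filter.Tendsto (fun k => nu (f k) E) u (nhds m) := by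
    intro E
    have hc : IsCompact (Set.Icc (0 : ℝ) 1) := isCompact_Icc
    have := hc.ultrafilter_le_nhds (u.map fun k => nu (f k) E) (by
      rw [Filter.le_principal_iff, Ultrafilter.mem_coe, Ultrafilter.mem_map]
      apply Filter.univ_mem'
      intro k
      refine ⟨measureReal_nonneg, (nu_le _ _).trans ?_⟩
      exact pow_le_one₀ (norm_nonneg _) (hf1 k))
    obtain ⟨m, _, hm⟩ := this
    exact ⟨m, hm⟩
  choose M hMt using hex
  refine ⟨M, ⟨?_, ?_, ?_, ?_, ?_, ?_⟩, ?_⟩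
  · intro E
    exact ge_of_tendsto' (hMt E) fun k => measureReal_nonneg
  · intro E F hEF
    exact le_of_tendsto_of_tendsto' (hMt E) (hMt F) fun k => measureReal_mono hEF
  · apply tendsto_nhds_unique (hMt Set.univ)
    simp only [nu_univ]
    simpa using (hf.mono_left hule).pow 2
  · apply tendsto_nhds_unique (hMt {0})
    have : ∀ k, nu (f k) {0} = 0 := by
      intro k
      rw [nu_eq _ (measurableSet_singleton _)]
      simp
    simp only [this]
    exact tendsto_const_nhds
  · intro E F
    exact le_of_tendsto_of_tendsto' (hMt _) ((hMt E).add (hMt F)) fun k => measureReal_union_le _ _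
  · intro E F hE hF hd
    apply tendsto_nhds_unique (hMt _)
    refine ((hMt E).add (hMt F)).congr fun k => ?_
    exact (measureReal_union hd hF).symm
  · intro i E hE
    have hpre : MeasurableSet (toEuc (A i) ⁻¹' E) := (toEuc (A i)).continuous.measurable hE
    have h0 : Filter.Tendsto (fun k => nu (f k) (toEuc (A i) ⁻¹' E) - nu (f k) E) u (nhds 0) := by
      apply squeeze_zero_norm (a := fun k => ‖f k - U (A i) (f k)‖ * 2)
      · intro k
        rw [Real.norm_eq_abs, ← nu_preimage (A i) (f k) hE]
        refine (nu_sub_le _ _ hpre).trans ?_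
        gcongr
        refine (norm_add_le _ _).trans ?_
        rw [norm_U]
        linarith [hf1 k]
      · simpa using ((hA i).mono_left hule).mul_const 2
    have h1 := tendsto_nhds_unique h0 ((hMt _).sub (hMt E))
    linarith

/-- The Markov operator and its lazy version. -/
def Pop {κ : ℕ} (p : Fin κ → ℝ) (A : Fin κ → SL2) : H2 →L[ℝ] H2 := ∑ i, p i • U (A i)

lemma Pop_apply {κ : ℕ} (p : Fin κ → ℝ) (A : Fin κ → SL2) (f : H2) :
    Pop p A f = ∑ i, p i • U (A i) f := by
  simp [Pop]

def Tlz {κ : ℕ} (p : Fin κ → ℝ) (A : Fin κ → SL2) : H2 →L[ℝ] H2 := (1 / 2 : ℝ) • (1 + Pop p A)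

lemma Tlz_bound {κ : ℕ} (p : Fin κ → ℝ) (hp : ∀ i, 0 < p i) (hp1 : ∑ i, p i = 1)
    (A : Fin κ → SL2) (i : Fin κ) (f : H2) (hf : ‖f‖ ≤ 1) :
    ‖Tlz p A f‖ ≤ (1 - p i) + p i / 2 * ‖f + U (A i) f‖ := by
  classical
  have h1 : Tlz p A f = ∑ j, (p j / 2) • (f + U (A j) f) := by
    simp only [smul_add, Finset.sum_add_distrib]
    rw [Tlz, smul_apply, ContinuousLinearMap.add_apply, Pop_apply, smul_add]
    congr 1
    · rw [← Finset.sum_smul, ← Finset.sum_div, hp1]; rfl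
    · rw [Finset.smul_sum]
      refine Finset.sum_congr rfl fun j _ => ?_
      rw [smul_smul]; congr 1; ring
  have hb : ∀ j, ‖f + U (A j) f‖ ≤ 2 := fun j => by
    refine (norm_add_le _ _).trans ?_
    rw [norm_U]; linarith
  rw [h1, ← Finset.add_sum_erase _ _ (Finset.mem_univ i)]
  refine (norm_add_le _ _).trans ?_
  have h2 : ‖∑ j ∈ Finset.univ.erase i, (p j / 2) • (f + U (A j) f)‖ ≤
      ∑ j ∈ Finset.univ.erase i, p j := by
    refine norm_sum_le_of_le _ fun j _ => ?_
    rw [norm_smul, Real.norm_eq_abs, abs_of_pos (by have := hp j; positivity)]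
    have := mul_le_mul_of_nonneg_left (hb j) (hp j).le
    linarith
  have h3 : ∑ j ∈ Finset.univ.erase i, p j = 1 - p i := by
    rw [← hp1, ← Finset.add_sum_erase _ _ (Finset.mem_univ i)]; ring
  rw [norm_smul, Real.norm_eq_abs, abs_of_pos (by have := hp i; positivity)]
  linarith

lemma norm_Tlz_lt {κ : ℕ} (hκ : 2 ≤ κ) (p : Fin κ → ℝ)
    (hp : ∀ i, 0 < p i) (hp1 : ∑ i, p i = 1) (A : Fin κ → SL2)
    (hSI : StronglyIrreducible A)
    (hUnb : ¬ ∃ C : ℝ, ∀ g : SL2, g ∈ Subsemigroup.closure (Set.range A) →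
      opNorm (g : Mat2) ≤ C) : ‖Tlz p A‖ < 1 := by
  by_contra hge
  push Not at hge
  have hx : ∀ k : ℕ, ∃ f : H2, ‖f‖ ≤ 1 ∧ 1 - 1 / ((k : ℝ) + 1) < ‖Tlz p A f‖ := by
    intro k
    have hk : 0 < 1 / ((k : ℝ) + 1) := by positivity
    obtain ⟨f, hf, hlt⟩ := (Tlz p A).exists_lt_apply_of_lt_opNorm
      (r := 1 - 1 / ((k : ℝ) + 1)) (by linarith)
    exact ⟨f, hf.le, hlt⟩
  choose f hf1 hfl using hx
  have hδ : Filter.Tendsto (fun k : ℕ => 1 / ((k : ℝ) + 1)) Filter.atTop (nhds 0) :=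
    tendsto_one_div_add_atTop_nhds_zero_nat
  have hlow : ∀ i (k : ℕ), 2 - 2 / p i * (1 / ((k : ℝ) + 1)) ≤ ‖f k + U (A i) (f k)‖ := by
    intro i k
    have h := (hfl k).le.trans (Tlz_bound p hp hp1 A i (f k) (hf1 k))
    have hpi := hp i
    have h2 : p i / 2 * (2 - 2 / p i * (1 / ((k : ℝ) + 1))) ≤
        p i / 2 * ‖f k + U (A i) (f k)‖ := by
      have : p i / 2 * (2 - 2 / p i * (1 / ((k : ℝ) + 1))) = p i - 1 / ((k : ℝ) + 1) := by
        field_simp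
      rw [this]; linarith
    exact le_of_mul_le_mul_left h2 (by positivity)
  have hsum : ∀ i k, ‖f k + U (A i) (f k)‖ ≤ 2 * ‖f k‖ := by
    intro i k
    refine (norm_add_le _ _).trans ?_
    rw [norm_U]; linarith
  have hlim : ∀ i, Filter.Tendsto (fun k => ‖f k + U (A i) (f k)‖) Filter.atTop (nhds 2) := by
    intro i
    refine tendsto_of_tendsto_of_tendsto_of_le_of_le (g := fun k : ℕ =>
      2 - 2 / p i * (1 / ((k : ℝ) + 1))) (h := fun _ => 2) ?_ tendsto_const_nhds (hlow i) ?_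
    · simpa using (hδ.const_mul (2 / p i)).const_sub 2
    · intro k
      have := hsum i k
      have := hf1 k
      show _ ≤ (2 : ℝ)
      linarith
  have hfn : Filter.Tendsto (fun k => ‖f k‖) Filter.atTop (nhds 1) := by
    refine tendsto_of_tendsto_of_tendsto_of_le_of_le
      (g := fun k : ℕ => ‖f k + U (A ⟨0, by omega⟩) (f k)‖ / 2) (h := fun _ => 1) ?_
      tendsto_const_nhds ?_ hf1
    · simpa using (hlim ⟨0, by omega⟩).div_const 2
    · intro k
      have := hsum ⟨0, by omega⟩ k
      show _ / 2 ≤ _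
      linarith
  obtain ⟨M, hM, hinv⟩ := mean_of_almost_invariant (A := A) f hf1 hfn (by
    intro i
    have h1 : Filter.Tendsto (fun k => Real.sqrt (4 - ‖f k + U (A i) (f k)‖ ^ 2)) Filter.atTop
        (nhds 0) := by
      have := (((hlim i).pow 2).const_sub 4).sqrt
      convert this using 2
      norm_num
    refine squeeze_zero (fun k => norm_nonneg _) (fun k => ?_) h1
    apply Real.le_sqrt_of_sq_le
    have hpar := parallelogram_law_with_norm ℝ (f k) (U (A i) (f k))
    rw [norm_U] at hpar
    have h2 := hf1 k
    have h3 := norm_nonneg (f k)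
    nlinarith)
  exact no_mean hSI hUnb hM hinv

/-! ### Part 4: random words -/

lemma wordProd_cons {κ : ℕ} (A : Fin κ → SL2) {n : ℕ} (i : Fin κ) (w : Fin n → Fin κ) :
    wordProd A (Fin.cons i w : Fin (n + 1) → Fin κ) = wordProd A w * A i := by
  simp [wordProd, List.ofFn_succ]

/-- Expectation over words of length `n`. -/
def Sw {X : Type*} [AddCommGroup X] [Module ℝ X] {κ : ℕ} (p : Fin κ → ℝ) (A : Fin κ → SL2)
    (n : ℕ) (F : SL2 → X) : X := ∑ w : Fin n → Fin κ, (∏ i, p (w i)) • F (wordProd A w)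

section words
variable {X : Type*} [AddCommGroup X] [Module ℝ X] {κ : ℕ} (p : Fin κ → ℝ) (A : Fin κ → SL2)

lemma Sw_zero (F : SL2 → X) : Sw p A 0 F = F 1 := by
  simp [Sw, wordProd]

lemma Sw_succ (n : ℕ) (F : SL2 → X) :
    Sw p A (n + 1) F = ∑ i, p i • Sw p A n (fun g => F (g * A i)) := by
  unfold Sw
  rw [← (Fin.consEquiv (fun _ : Fin (n + 1) => Fin κ)).sum_comp, Fintype.sum_prod_type]
  refine Finset.sum_congr rfl fun i _ => ?_
  rw [Finset.smul_sum]
  refine Finset.sum_congr rfl fun w _ => ?_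
  simp only [Fin.consEquiv, Equiv.coe_fn_mk]
  rw [wordProd_cons, Fin.prod_univ_succ, mul_smul]
  simp

lemma Sw_map {Y : Type*} [AddCommGroup Y] [Module ℝ Y] (L : X →ₗ[ℝ] Y) (n : ℕ) (F : SL2 → X) :
    L (Sw p A n F) = Sw p A n (fun g => L (F g)) := by
  simp [Sw, map_sum]

lemma Sw_add (m n : ℕ) (F : SL2 → X) :
    Sw p A (m + n) F = Sw p A n (fun h => Sw p A m (fun g => F (g * h))) := by
  induction n generalizing F with
  | zero => simp [Sw_zero]
  | succ n ih =>
    rw [← add_assoc, Sw_succ, Sw_succ]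
    refine Finset.sum_congr rfl fun i _ => ?_
    rw [ih]
    simp [mul_assoc]

lemma Sw_one (hp1 : ∑ i, p i = 1) (n : ℕ) : Sw p A n (fun _ => (1 : ℝ)) = 1 := by
  induction n with
  | zero => simp [Sw_zero]
  | succ n ih => rw [Sw_succ]; simp [ih, hp1]

lemma Sw_mono (hp : ∀ i, 0 < p i) (n : ℕ) {F G : SL2 → ℝ} (h : ∀ g, F g ≤ G g) :
    Sw p A n F ≤ Sw p A n G := by
  unfold Sw
  refine Finset.sum_le_sum fun w _ => ?_
  exact mul_le_mul_of_nonneg_left (h _) (Finset.prod_nonneg fun i _ => (hp _).le)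

lemma Pop_pow (n : ℕ) : Pop p A ^ n = Sw p A n U := by
  induction n with
  | zero => rw [Sw_zero, pow_zero, U_one]
  | succ n ih =>
    rw [pow_succ', ih, Sw_succ, Pop, Finset.sum_mul]
    refine Finset.sum_congr rfl fun i _ => ?_
    rw [smul_mul_assoc]
    congr 1
    simp only [U_mul]
    exact Sw_map p A (LinearMap.mulLeft ℝ (U (A i))) n U

end words

lemma one_le_opNorm (g : SL2) : 1 ≤ opNorm (g : Mat2) := by
  set v : E2 := !₂[1, 0] with hv
  set w : E2 := !₂[0, 1] with hw
  have h1 := abs_dt_le (toEuc g v) (toEuc g w)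
  rw [dt_toEuc] at h1
  have hd : dt v w = 1 := by simp [dt, hv, hw]
  have hvn : ‖v‖ = 1 := by
    have := norm_sq_E2 v
    have h2 : v 0 ^ 2 + v 1 ^ 2 = 1 := by simp [hv]
    rw [h2] at this
    exact (pow_eq_one_iff_of_nonneg (norm_nonneg v) two_ne_zero).mp this
  have hwn : ‖w‖ = 1 := by
    have := norm_sq_E2 w
    have h2 : w 0 ^ 2 + w 1 ^ 2 = 1 := by simp [hw]
    rw [h2] at this
    exact (pow_eq_one_iff_of_nonneg (norm_nonneg w) two_ne_zero).mp this
  have h2 := (toEuc g).le_opNorm v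
  have h3 := (toEuc g).le_opNorm w
  rw [hvn, mul_one] at h2
  rw [hwn, mul_one] at h3
  rw [hd, abs_one] at h1
  have h4 : ‖toEuc g v‖ * ‖toEuc g w‖ ≤ ‖toEuc g‖ * ‖toEuc g‖ := by gcongr
  change 1 ≤ ‖toEuc g‖
  nlinarith [norm_nonneg (toEuc g)]

lemma opNorm_mul_le (g h : SL2) :
    opNorm ((g * h : SL2) : Mat2) ≤ opNorm (g : Mat2) * opNorm (h : Mat2) := by
  change ‖toEuc (g * h)‖ ≤ ‖toEuc g‖ * ‖toEuc h‖
  rw [toEuc_mul]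
  exact norm_mul_le _ _

/-- The indicator function of the unit ball. -/
def fB : H2 := indicatorConstLp 2 (measurableSet_ball (x := (0 : E2)) (ε := 1))
  (measure_ball_lt_top).ne (1 : ℝ)

def vB : ℝ := (volume : Measure E2).real (Metric.ball 0 1)

lemma vB_pos : 0 < vB := by
  unfold vB
  exact ENNReal.toReal_pos (Metric.measure_ball_pos _ _ one_pos).ne' (measure_ball_lt_top).ne

lemma norm_fB_sq : ‖fB‖ * ‖fB‖ = vB := by
  rw [← real_inner_self_eq_norm_mul_norm, fB,
    L2.real_inner_indicatorConstLp_one_indicatorConstLp_one, Set.inter_self, vB]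

lemma inner_fB (g : SL2) : vB * (opNorm (g : Mat2) ^ 2)⁻¹ ≤ inner ℝ fB (U g fB) := by
  have hg1 := one_le_opNorm g
  have hgpos : 0 < opNorm (g : Mat2) := by linarith
  have hμt : volume (toEuc g ⁻¹' Metric.ball (0 : E2) 1) ≠ ⊤ := by
    rw [(mp_toEuc g).measure_preimage measurableSet_ball.nullMeasurableSet]
    exact measure_ball_lt_top.ne
  rw [U_apply]
  unfold fB
  rw [Lp.indicatorConstLp_compMeasurePreserving,
    L2.real_inner_indicatorConstLp_one_indicatorConstLp_one (hμt := hμt)]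
  have hsub : Metric.ball (0 : E2) (opNorm (g : Mat2))⁻¹ ⊆
      Metric.ball 0 1 ∩ toEuc g ⁻¹' Metric.ball 0 1 := by
    intro x hx
    have hx' : ‖x‖ < (opNorm (g : Mat2))⁻¹ := by simpa using hx
    constructor
    · have : (opNorm (g : Mat2))⁻¹ ≤ 1 := inv_le_one_of_one_le₀ hg1
      simpa using hx'.trans_le this
    · have h1 : ‖toEuc g x‖ ≤ opNorm (g : Mat2) * ‖x‖ := (toEuc g).le_opNorm x
      have h2 : opNorm (g : Mat2) * ‖x‖ < opNorm (g : Mat2) * (opNorm (g : Mat2))⁻¹ := by gcongr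
      rw [mul_inv_cancel₀ hgpos.ne'] at h2
      simpa using h1.trans_lt h2
  refine le_trans (le_of_eq ?_) (measureReal_mono hsub
    ((measure_mono Set.inter_subset_left).trans_lt measure_ball_lt_top).ne)
  rw [Measure.real, Measure.addHaar_ball _ _ (by positivity), ENNReal.toReal_mul,
    ENNReal.toReal_ofReal (by positivity)]
  simp only [finrank_euclideanSpace, Fintype.card_fin, vB, Measure.real]
  rw [inv_pow, mul_comm]

/-- The expectation of `‖A^n‖⁻²`. -/
def bb {κ : ℕ} (p : Fin κ → ℝ) (A : Fin κ → SL2) (n : ℕ) : ℝ :=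
  Sw p A n fun g => (opNorm (g : Mat2) ^ 2)⁻¹

section final
variable {κ : ℕ} (p : Fin κ → ℝ) (A : Fin κ → SL2)

lemma bb_add (hp : ∀ i, 0 < p i) (m n : ℕ) : bb p A m * bb p A n ≤ bb p A (m + n) := by
  unfold bb
  rw [Sw_add]
  have h1 : Sw p A m (fun g => (opNorm (g : Mat2) ^ 2)⁻¹) *
      Sw p A n (fun g => (opNorm (g : Mat2) ^ 2)⁻¹) =
      Sw p A n (fun h => Sw p A m (fun g => (opNorm (h : Mat2) ^ 2)⁻¹ *
        (opNorm (g : Mat2) ^ 2)⁻¹)) := by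
    rw [mul_comm, Sw, Finset.sum_mul]
    refine Finset.sum_congr rfl fun w _ => ?_
    rw [smul_mul_assoc]
    congr 1
    exact Sw_map (X := ℝ) (Y := ℝ) p A
      (LinearMap.mulLeft ℝ ((opNorm ((wordProd A w : SL2) : Mat2) ^ 2)⁻¹)) m _
  rw [h1]
  refine Sw_mono p A hp n fun h => Sw_mono p A hp m fun g => ?_
  rw [← mul_inv, ← mul_pow]
  have := one_le_opNorm (g * h)
  apply inv_anti₀ (by positivity)
  have h2 := opNorm_mul_le g h
  rw [mul_comm (opNorm (h : Mat2))]
  gcongr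

lemma wprod_pos (hp : ∀ i, 0 < p i) {n : ℕ} (w : Fin n → Fin κ) : 0 < ∏ i, p (w i) :=
  Finset.prod_pos fun i _ => hp _

lemma sum_wprod (hp1 : ∑ i, p i = 1) (n : ℕ) : ∑ w : Fin n → Fin κ, ∏ i, p (w i) = 1 := by
  have := Sw_one p (fun _ => (1 : SL2)) hp1 n
  simpa [Sw] using this

def aa (n : ℕ) : ℝ := ∑ w : Fin n → Fin κ,
      (∏ i, p (w i)) * Real.log (opNorm ((wordProd A w : SL2) : Mat2))

lemma aa_nonneg (hp : ∀ i, 0 < p i) (n : ℕ) : 0 ≤ aa p A n :=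
  Finset.sum_nonneg fun w _ => mul_nonneg (wprod_pos p hp w).le
    (Real.log_nonneg (one_le_opNorm _))

lemma bb_ge (hp : ∀ i, 0 < p i) (hp1 : ∑ i, p i = 1) (n : ℕ) :
    Real.exp (-2 * aa p A n) ≤ bb p A n := by
  have h := convexOn_exp.map_sum_le (t := (Finset.univ : Finset (Fin n → Fin κ)))
    (w := fun w => ∏ i, p (w i))
    (p := fun w => -2 * Real.log (opNorm ((wordProd A w : SL2) : Mat2)))
    (fun w _ => (wprod_pos p hp w).le) (sum_wprod p hp1 n) (fun _ _ => Set.mem_univ _)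
  refine le_trans (le_of_eq ?_) (h.trans (le_of_eq ?_))
  · congr 1
    unfold aa
    rw [Finset.mul_sum]
    refine Finset.sum_congr rfl fun w _ => ?_
    simp only [smul_eq_mul]; ring
  · unfold bb Sw
    refine Finset.sum_congr rfl fun w _ => ?_
    congr 1
    have h1 : 0 < opNorm ((wordProd A w : SL2) : Mat2) := by
      have := one_le_opNorm (wordProd A w); linarith
    change _ = (opNorm ((wordProd A w : SL2) : Mat2) ^ 2)⁻¹
    rw [show -2 * Real.log (opNorm ((wordProd A w : SL2) : Mat2)) =
      -(Real.log (opNorm ((wordProd A w : SL2) : Mat2)) +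
        Real.log (opNorm ((wordProd A w : SL2) : Mat2))) by ring, Real.exp_neg, Real.exp_add,
      Real.exp_log h1, sq]

lemma bb_pos (hp : ∀ i, 0 < p i) (hp1 : ∑ i, p i = 1) (n : ℕ) : 0 < bb p A n :=
  (Real.exp_pos _).trans_le (bb_ge p A hp hp1 n)

lemma bb_lower (hp : ∀ i, 0 < p i) (hp1 : ∑ i, p i = 1) (m : ℕ) (hm : 0 < m) (t : ℝ)
    (ht0 : 0 ≤ t) (ht1 : t ≤ 1) (ht : t ^ m ≤ bb p A m) :
    ∃ c : ℝ, 0 < c ∧ ∀ k, c * t ^ k ≤ bb p A k := by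
  obtain ⟨r0, _, hr0⟩ := Finset.exists_min_image (Finset.range m) (bb p A)
    ⟨0, Finset.mem_range.mpr hm⟩
  refine ⟨bb p A r0, bb_pos p A hp hp1 _, ?_⟩
  intro k
  induction k using Nat.strong_induction_on with
  | _ k ih =>
    have hc := bb_pos p A hp hp1 r0
    by_cases hk : k < m
    · refine le_trans ?_ (hr0 k (Finset.mem_range.mpr hk))
      have : t ^ k ≤ 1 := pow_le_one₀ ht0 ht1
      nlinarith
    · have h1 := ih (k - m) (by omega)
      have h2 := bb_add p A hp (k - m) m
      rw [Nat.sub_add_cancel (by omega)] at h2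
      calc bb p A r0 * t ^ k = (bb p A r0 * t ^ (k - m)) * t ^ m := by
            rw [mul_assoc, ← pow_add, Nat.sub_add_cancel (by omega)]
        _ ≤ bb p A (k - m) * bb p A m := by
            have := bb_pos p A hp hp1 (k - m)
            gcongr
        _ ≤ _ := h2

lemma inner_Pop_pow (hp : ∀ i, 0 < p i) (k : ℕ) :
    vB * bb p A k ≤ inner ℝ fB ((Pop p A ^ k) fB) := by
  have h1 : inner ℝ fB ((Pop p A ^ k) fB) = Sw p A k (fun g => inner ℝ fB (U g fB)) := by
    rw [Pop_pow]
    exact Sw_map p A ((innerSL ℝ fB).toLinearMap ∘ₗ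
      (ContinuousLinearMap.apply ℝ H2 fB).toLinearMap) k U
  have h2 : vB * bb p A k = Sw p A k (fun g => vB * (opNorm (g : Mat2) ^ 2)⁻¹) :=
    Sw_map p A (LinearMap.mulLeft ℝ vB) k _
  rw [h1, h2]
  exact Sw_mono p A hp k inner_fB

lemma lazy_lower (hp : ∀ i, 0 < p i) (c t : ℝ) (h : ∀ k, c * t ^ k ≤ bb p A k) (n : ℕ) :
    vB * c * ((1 + t) / 2) ^ n ≤ inner ℝ fB ((Tlz p A ^ n) fB) := by
  have h1 : Tlz p A ^ n = (1 / 2 : ℝ) ^ n • ∑ k ∈ Finset.range (n + 1),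
      (n.choose k : ℝ) • Pop p A ^ k := by
    rw [Tlz, smul_pow, add_comm, (Commute.one_right (Pop p A)).add_pow]
    congr 1
    refine Finset.sum_congr rfl fun k _ => ?_
    rw [one_pow, mul_one, ← nsmul_eq_mul', Nat.cast_smul_eq_nsmul]
  have h2 : inner ℝ fB ((Tlz p A ^ n) fB) = (1 / 2 : ℝ) ^ n * ∑ k ∈ Finset.range (n + 1),
      (n.choose k : ℝ) * inner ℝ fB ((Pop p A ^ k) fB) := by
    rw [h1, smul_apply, inner_smul_right, sum_apply, inner_sum]
    congr 1
    refine Finset.sum_congr rfl fun k _ => ?_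
    rw [smul_apply, inner_smul_right]
  have h3 : vB * c * ((1 + t) / 2) ^ n = (1 / 2 : ℝ) ^ n * ∑ k ∈ Finset.range (n + 1),
      (n.choose k : ℝ) * (vB * (c * t ^ k)) := by
    rw [show (1 + t) / 2 = (1 / 2) * (t + 1) by ring, mul_pow, add_pow]
    simp only [Finset.mul_sum]
    refine Finset.sum_congr rfl fun k _ => ?_
    rw [one_pow]; ring
  rw [h2, h3]
  have := vB_pos
  gcongr with k _
  refine le_trans ?_ (inner_Pop_pow p A hp k)
  gcongr
  exact h k

lemma le_of_pow_le {c x ρ : ℝ} (hc : 0 < c) (hρ : 0 ≤ ρ)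
    (h : ∀ n : ℕ, c * x ^ n ≤ ρ ^ n) : x ≤ ρ := by
  by_contra hlt
  push Not at hlt
  have hx : 0 < x := hρ.trans_lt hlt
  have h1 : Filter.Tendsto (fun n : ℕ => (ρ / x) ^ n) Filter.atTop (nhds 0) :=
    tendsto_pow_atTop_nhds_zero_of_lt_one (by positivity) ((div_lt_one hx).mpr hlt)
  have h2 : c ≤ 0 := by
    refine ge_of_tendsto' h1 fun n => ?_
    rw [div_pow, le_div_iff₀ (by positivity)]
    exact h n
  linarith

lemma aa_lower (hp : ∀ i, 0 < p i) (hp1 : ∑ i, p i = 1) (m : ℕ) (hm : 0 < m) :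
    (1 + Real.exp (-2 * ((m : ℝ)⁻¹ * aa p A m))) / 2 ≤ ‖Tlz p A‖ := by
  have hmR : (0 : ℝ) < m := by exact_mod_cast hm
  have ha := aa_nonneg p A hp m
  obtain ⟨c, hc, h⟩ := bb_lower p A hp hp1 m hm (Real.exp (-2 * ((m : ℝ)⁻¹ * aa p A m)))
    (Real.exp_pos _).le
    (by
      rw [Real.exp_le_one_iff]
      have : 0 ≤ (m : ℝ)⁻¹ * aa p A m := by positivity
      linarith)
    (by
      rw [← Real.exp_nat_mul]
      refine le_trans (le_of_eq ?_) (bb_ge p A hp hp1 m)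
      congr 1
      field_simp)
  apply le_of_pow_le hc (norm_nonneg _)
  intro n
  have h1 := lazy_lower p A hp c _ h n
  have h2 : inner ℝ fB ((Tlz p A ^ n) fB) ≤ ‖Tlz p A‖ ^ n * vB := by
    calc inner ℝ fB ((Tlz p A ^ n) fB) ≤ ‖fB‖ * ‖(Tlz p A ^ n) fB‖ := real_inner_le_norm _ _
      _ ≤ ‖fB‖ * (‖Tlz p A ^ n‖ * ‖fB‖) := by
        gcongr; exact (Tlz p A ^ n).le_opNorm fB
      _ ≤ ‖fB‖ * (‖Tlz p A‖ ^ n * ‖fB‖) := by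
        have : ‖Tlz p A ^ n‖ ≤ ‖Tlz p A‖ ^ n := by
          rcases Nat.eq_zero_or_pos n with rfl | hn
          · rw [pow_zero, pow_zero]; exact ContinuousLinearMap.norm_id_le
          · exact norm_pow_le' _ hn
        gcongr
      _ = ‖Tlz p A‖ ^ n * (‖fB‖ * ‖fB‖) := by ring
      _ = _ := by rw [norm_fB_sq]
  have hv := vB_pos
  have h3 := h1.trans h2
  rw [mul_assoc, mul_comm _ vB] at h3
  exact le_of_mul_le_mul_left h3 hv

end final

/-- **Furstenberg's criterion.** If `A` is strongly irreducible and the semigroup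
generated by `A_1, …, A_κ` is unbounded, then `L(A) > 0`. -/
theorem furstenberg_criterion {κ : ℕ} (hκ : 2 ≤ κ) (p : Fin κ → ℝ)
    (hp : ∀ i, 0 < p i) (hp1 : ∑ i, p i = 1) (A : Fin κ → SL2)
    (hSI : StronglyIrreducible A)
    (hUnb : ¬ ∃ C : ℝ, ∀ g : SL2, g ∈ Subsemigroup.closure (Set.range A) →
      opNorm (g : Mat2) ≤ C) :
    0 < lyapLC p A := by
  have hT := norm_Tlz_lt hκ p hp hp1 A hSI hUnb
  set s : ℝ := max (2 * ‖Tlz p A‖ - 1) (1 / 2) with hs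
  have hs0 : 0 < s := lt_of_lt_of_le (by norm_num) (le_max_right _ _)
  have hs1 : s < 1 := max_lt (by linarith) (by norm_num)
  have hlog : Real.log s < 0 := Real.log_neg hs0 hs1
  have hb : -(1 / 2) * Real.log s ≤ lyapLC p A := by
    unfold lyapLC
    have : Nonempty {m : ℕ // 0 < m} := ⟨⟨1, one_pos⟩⟩
    refine le_ciInf fun m => ?_
    change _ ≤ ((m : ℕ) : ℝ)⁻¹ * aa p A m
    have h1 := aa_lower p A hp hp1 m m.2
    have h2 : Real.exp (-2 * (((m : ℕ) : ℝ)⁻¹ * aa p A m)) ≤ s :=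
      le_trans (by linarith) (le_max_left _ _)
    rw [← Real.le_log_iff_exp_le hs0] at h2
    linarith
  linarith
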